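/- The quantity λ₁ satisfies inf_{x ∈ [0,1]²} |F₀(x)| ≤ λ₁ ≤ sup_{x ∈ [0,1]²} |F₀(x)|. -/

import Mathlib

open MeasureTheory Complex

noncomputable section

/-- Partial derivative in the first coordinate direction. -/
def pd1 {E : Type*} [NormedAddCommGroup E] [NormedSpace ℝ E]
    (f : ℝ × ℝ → E) (x : ℝ × ℝ) : E := fderiv ℝ f x (1, 0)

/-- Partial derivative in the second coordinate direction. -/
def pd2 {E : Type*} [NormedAddCommGroup E] [NormedSpace ℝ E]
    (f : ℝ × ℝ → E) (x : ℝ × ℝ) : E := fderiv ℝ f x (0, 1)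

/-- Covariant derivative `D₁φ = ∂₁φ + i a₁ φ`. -/
def D1 (a1 : ℝ × ℝ → ℝ) (φ : ℝ × ℝ → ℂ) : ℝ × ℝ → ℂ :=
  fun x => pd1 φ x + Complex.I * (a1 x : ℂ) * φ x

/-- Covariant derivative `D₂φ = ∂₂φ + i a₂ φ`. -/
def D2 (a2 : ℝ × ℝ → ℝ) (φ : ℝ × ℝ → ℂ) : ℝ × ℝ → ℂ :=
  fun x => pd2 φ x + Complex.I * (a2 x : ℂ) * φ x

/-- Curvature `F(a) = ∂₁a₂ − ∂₂a₁`. -/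
def curv (a1 a2 : ℝ × ℝ → ℝ) : ℝ × ℝ → ℝ :=
  fun x => pd1 a2 x - pd2 a1 x

/-- The fundamental domain `[0,1]²`. -/
def unitSquare : Set (ℝ × ℝ) := Set.Icc (0, 0) (1, 1)

/-- A degree-`d` field pair on the torus: smooth quasi-periodic `(a, φ)`. -/
structure FieldPair (d : ℤ) where
  a1 : ℝ × ℝ → ℝ
  a2 : ℝ × ℝ → ℝ
  φ : ℝ × ℝ → ℂ
  smooth_a1 : ContDiff ℝ (⊤ : ℕ∞) a1
  smooth_a2 : ContDiff ℝ (⊤ : ℕ∞) a2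
  smooth_φ : ContDiff ℝ (⊤ : ℕ∞) φ
  per1_a1 : ∀ x : ℝ × ℝ, a1 (x.1 + 1, x.2) = a1 x
  per1_a2 : ∀ x : ℝ × ℝ, a2 (x.1 + 1, x.2) = a2 x
  per1_φ : ∀ x : ℝ × ℝ, φ (x.1 + 1, x.2) = φ x
  per2_a2 : ∀ x : ℝ × ℝ, a2 (x.1, x.2 + 1) = a2 x
  per2_a1 : ∀ x : ℝ × ℝ, a1 (x.1, x.2 + 1) = a1 x - 2 * Real.pi * d
  per2_φ : ∀ x : ℝ × ℝ, φ (x.1, x.2 + 1) =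
      Complex.exp (2 * Real.pi * Complex.I * (d : ℂ) * (x.1 : ℂ)) * φ x

/-- The smooth ℤ²-periodic external field with `∫_{[0,1]²} F₀ = 2πd`. -/
def ExternalField (d : ℤ) (F₀ : ℝ × ℝ → ℝ) : Prop :=
  ContDiff ℝ (⊤ : ℕ∞) F₀ ∧ (∀ x : ℝ × ℝ, F₀ (x.1 + 1, x.2) = F₀ x) ∧
    (∀ x : ℝ × ℝ, F₀ (x.1, x.2 + 1) = F₀ x) ∧
    (∫ x in unitSquare, F₀ x) = 2 * Real.pi * d

/-- The Ginzburg–Landau free energy. -/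
def energy (α β : ℝ) (F₀ : ℝ × ℝ → ℝ) {d : ℤ} (P : FieldPair d) : ℝ :=
  (1 / 2) * ∫ x in unitSquare,
    ((curv P.a1 P.a2 x - F₀ x) ^ 2 + ‖D1 P.a1 P.φ x‖ ^ 2 + ‖D2 P.a2 P.φ x‖ ^ 2
      - α * ‖P.φ x‖ ^ 2 + (β / 2) * ‖P.φ x‖ ^ 4)

/-- The Ginzburg–Landau equations. -/
def IsGLSolution (α β : ℝ) (F₀ : ℝ × ℝ → ℝ) {d : ℤ} (P : FieldPair d) : Prop :=
  (∀ x : ℝ × ℝ,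
      pd2 (fun y => curv P.a1 P.a2 y - F₀ y) x
        + ((starRingEnd ℂ) (P.φ x) * D1 P.a1 P.φ x).im = 0) ∧
  (∀ x : ℝ × ℝ,
      -pd1 (fun y => curv P.a1 P.a2 y - F₀ y) x
        + ((starRingEnd ℂ) (P.φ x) * D2 P.a2 P.φ x).im = 0) ∧
  (∀ x : ℝ × ℝ,
      -(D1 P.a1 (D1 P.a1 P.φ) x + D2 P.a2 (D2 P.a2 P.φ) x)
        = (α : ℂ) * P.φ x - (β : ℂ) * (‖P.φ x‖ : ℂ) ^ 2 * P.φ x)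

/-- The set of energies of all degree-`d` field pairs. -/
def energySet (α β : ℝ) (F₀ : ℝ × ℝ → ℝ) (d : ℤ) : Set ℝ :=
  { t : ℝ | ∃ P : FieldPair d, t = energy α β F₀ P }

/-- `λ₁`, the lowest eigenvalue of the covariant Laplacian among connections
with curvature `F₀`. -/
def lambda1 (d : ℤ) (F₀ : ℝ × ℝ → ℝ) : ℝ :=
  sInf { t : ℝ | ∃ P : FieldPair d,
    (∀ x : ℝ × ℝ, curv P.a1 P.a2 x = F₀ x) ∧
    (∫ x in unitSquare, ‖P.φ x‖ ^ 2) = 1 ∧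
    t = ∫ x in unitSquare, (‖D1 P.a1 P.φ x‖ ^ 2 + ‖D2 P.a2 P.φ x‖ ^ 2) }


/-! ### Partial derivatives -/

section PartialDerivatives

variable {E : Type*} [NormedAddCommGroup E] [NormedSpace ℝ E] {f g : ℝ × ℝ → E} {x : ℝ × ℝ}

lemma ContDiff.differentiable_top (hf : ContDiff ℝ (⊤ : ℕ∞) f) : Differentiable ℝ f :=
  hf.differentiable (by simp)

lemma contDiff_pd1 (hf : ContDiff ℝ (⊤ : ℕ∞) f) : ContDiff ℝ (⊤ : ℕ∞) (pd1 f) :=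
  (hf.fderiv_right (m := (⊤ : ℕ∞)) (by simp)).clm_apply contDiff_const

lemma contDiff_pd2 (hf : ContDiff ℝ (⊤ : ℕ∞) f) : ContDiff ℝ (⊤ : ℕ∞) (pd2 f) :=
  (hf.fderiv_right (m := (⊤ : ℕ∞)) (by simp)).clm_apply contDiff_const

lemma pd1_pd2_comm (hf : ContDiff ℝ (⊤ : ℕ∞) f) : pd1 (pd2 f) x = pd2 (pd1 f) x := by
  have hd : DifferentiableAt ℝ (fderiv ℝ f) x :=
    ((hf.fderiv_right (m := (⊤ : ℕ∞)) (by simp)).differentiable (by simp)) x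
  have hs : IsSymmSndFDerivAt ℝ f x :=
    hf.contDiffAt.isSymmSndFDerivAt (by simpa using WithTop.coe_le_coe.2 (le_top : (2 : ℕ∞) ≤ ⊤))
  have key (v w : ℝ × ℝ) :
      fderiv ℝ (fun y => fderiv ℝ f y w) x v = fderiv ℝ (fderiv ℝ f) x v w := by
    rw [fderiv_clm_apply hd (differentiableAt_const w)]
    simp
  exact (key _ _).trans ((hs _ _).trans (key _ _).symm)

lemma pd1_add (hf : DifferentiableAt ℝ f x) (hg : DifferentiableAt ℝ g x) :
    pd1 (fun y => f y + g y) x = pd1 f x + pd1 g x := by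
  simp [pd1, fderiv_fun_add hf hg]

lemma pd2_add (hf : DifferentiableAt ℝ f x) (hg : DifferentiableAt ℝ g x) :
    pd2 (fun y => f y + g y) x = pd2 f x + pd2 g x := by
  simp [pd2, fderiv_fun_add hf hg]

lemma pd1_neg : pd1 (fun y => -f y) x = -pd1 f x := by
  simp [pd1, fderiv_fun_neg]

lemma pd2_neg : pd2 (fun y => -f y) x = -pd2 f x := by
  simp [pd2, fderiv_fun_neg]

lemma pd1_clm {G : Type*} [NormedAddCommGroup G] [NormedSpace ℝ G] (T : E →L[ℝ] G)
    (hf : DifferentiableAt ℝ f x) : pd1 (fun y => T (f y)) x = T (pd1 f x) := by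
  have := (T.hasFDerivAt.comp x hf.hasFDerivAt).fderiv
  simp only [Function.comp_def] at this
  simp [pd1, this]

lemma pd2_clm {G : Type*} [NormedAddCommGroup G] [NormedSpace ℝ G] (T : E →L[ℝ] G)
    (hf : DifferentiableAt ℝ f x) : pd2 (fun y => T (f y)) x = T (pd2 f x) := by
  have := (T.hasFDerivAt.comp x hf.hasFDerivAt).fderiv
  simp only [Function.comp_def] at this
  simp [pd2, this]

lemma pd1_mul {A : Type*} [NormedCommRing A] [NormedAlgebra ℝ A] {f g : ℝ × ℝ → A}
    (hf : DifferentiableAt ℝ f x) (hg : DifferentiableAt ℝ g x) :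
    pd1 (fun y => f y * g y) x = pd1 f x * g x + f x * pd1 g x := by
  simp [pd1, fderiv_fun_mul hf hg]; ring

lemma pd2_mul {A : Type*} [NormedCommRing A] [NormedAlgebra ℝ A] {f g : ℝ × ℝ → A}
    (hf : DifferentiableAt ℝ f x) (hg : DifferentiableAt ℝ g x) :
    pd2 (fun y => f y * g y) x = pd2 f x * g x + f x * pd2 g x := by
  simp [pd2, fderiv_fun_mul hf hg]; ring

lemma pd1_eq_of_hasFDerivAt {T : ℝ × ℝ →L[ℝ] E} (h : HasFDerivAt f T x) : pd1 f x = T (1, 0) := by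
  simp [pd1, h.fderiv]

lemma pd2_eq_of_hasFDerivAt {T : ℝ × ℝ →L[ℝ] E} (h : HasFDerivAt f T x) : pd2 f x = T (0, 1) := by
  simp [pd2, h.fderiv]

lemma pd1_eq_of_hasDerivAt {c : E} (hf : DifferentiableAt ℝ f x)
    (h : HasDerivAt (fun t => f (t, x.2)) c x.1) : pd1 f x = c := by
  have h1 : HasDerivAt (fun t : ℝ => (t, x.2)) ((1 : ℝ), (0 : ℝ)) x.1 :=
    (hasDerivAt_id _).prodMk (hasDerivAt_const _ _)
  exact (HasFDerivAt.comp_hasDerivAt x.1 (l := f) (l' := fderiv ℝ f x) hf.hasFDerivAt h1).unique h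

lemma pd2_eq_of_hasDerivAt {c : E} (hf : DifferentiableAt ℝ f x)
    (h : HasDerivAt (fun t => f (x.1, t)) c x.2) : pd2 f x = c := by
  have h1 : HasDerivAt (fun t : ℝ => (x.1, t)) ((0 : ℝ), (1 : ℝ)) x.2 :=
    (hasDerivAt_const _ _).prodMk (hasDerivAt_id _)
  exact (HasFDerivAt.comp_hasDerivAt x.2 (l := f) (l' := fderiv ℝ f x) hf.hasFDerivAt h1).unique h

lemma fderiv_shift1 : fderiv ℝ (fun y : ℝ × ℝ => f (y.1 + 1, y.2)) x =
    fderiv ℝ f (x.1 + 1, x.2) := by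
  have := fderiv_comp_add_right (𝕜 := ℝ) (f := f) (x := x) ((1 : ℝ), (0 : ℝ))
  have e (y : ℝ × ℝ) : y + ((1 : ℝ), (0 : ℝ)) = (y.1 + 1, y.2) := by ext <;> simp
  simpa only [e] using this

lemma fderiv_shift2 : fderiv ℝ (fun y : ℝ × ℝ => f (y.1, y.2 + 1)) x =
    fderiv ℝ f (x.1, x.2 + 1) := by
  have := fderiv_comp_add_right (𝕜 := ℝ) (f := f) (x := x) ((0 : ℝ), (1 : ℝ))
  have e (y : ℝ × ℝ) : y + ((0 : ℝ), (1 : ℝ)) = (y.1, y.2 + 1) := by ext <;> simp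
  simpa only [e] using this

end PartialDerivatives

/-- A function on the plane that is `1`-periodic in each coordinate. -/
def TorusPeriodic {E : Type*} (f : ℝ × ℝ → E) : Prop :=
  (∀ x : ℝ × ℝ, f (x.1 + 1, x.2) = f x) ∧ ∀ x : ℝ × ℝ, f (x.1, x.2 + 1) = f x

namespace TorusPeriodic

variable {E : Type*} [NormedAddCommGroup E] [NormedSpace ℝ E] {f g : ℝ × ℝ → E}

lemma fderiv (hf : TorusPeriodic f) : TorusPeriodic (fderiv ℝ f) :=
  ⟨fun x => by rw [← fderiv_shift1, funext hf.1], fun x => by rw [← fderiv_shift2, funext hf.2]⟩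

lemma pd1 (hf : TorusPeriodic f) : TorusPeriodic (pd1 f) :=
  ⟨fun x => congrArg (· (1, 0)) (hf.fderiv.1 x), fun x => congrArg (· (1, 0)) (hf.fderiv.2 x)⟩

lemma pd2 (hf : TorusPeriodic f) : TorusPeriodic (pd2 f) :=
  ⟨fun x => congrArg (· (0, 1)) (hf.fderiv.1 x), fun x => congrArg (· (0, 1)) (hf.fderiv.2 x)⟩

end TorusPeriodic

/-! ### Integration over the fundamental domain -/

lemma isCompact_unitSquare : IsCompact unitSquare := isCompact_Icc

lemma Continuous.integrableOn_unitSquare {E : Type*} [NormedAddCommGroup E] {f : ℝ × ℝ → E}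
    (hf : Continuous f) : IntegrableOn f unitSquare :=
  hf.continuousOn.integrableOn_compact isCompact_unitSquare

lemma setIntegral_unitSquare_const (c : ℝ) : ∫ _ in unitSquare, c = c := by
  have h : volume.real unitSquare = 1 := by
    rw [unitSquare, ← Set.Icc_prod_Icc, Measure.volume_eq_prod, measureReal_prod_prod]
    simp
  simp [h]

/-- The integral of the divergence of a vector field vanishes when each component is periodic
in its own direction. -/
lemma integral_divergence_unitSquare {f g : ℝ × ℝ → ℝ} (hf : ContDiff ℝ (⊤ : ℕ∞) f)
    (hg : ContDiff ℝ (⊤ : ℕ∞) g) (hf1 : ∀ x : ℝ × ℝ, f (x.1 + 1, x.2) = f x)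
    (hg2 : ∀ x : ℝ × ℝ, g (x.1, x.2 + 1) = g x) :
    ∫ x in unitSquare, (pd1 f x + pd2 g x) = 0 := by
  have key := integral_divergence_prod_Icc_of_hasFDerivAt_of_le f g (fderiv ℝ f) (fderiv ℝ g)
    (0, 0) (1, 1) (by simp [Prod.le_def]) hf.continuous.continuousOn hg.continuous.continuousOn
    (fun x _ => (hf.differentiable_top x).hasFDerivAt)
    (fun x _ => (hg.differentiable_top x).hasFDerivAt)
    (((contDiff_pd1 hf).continuous.add (contDiff_pd2 hg).continuous).integrableOn_unitSquare)
  have e1 (y : ℝ) : f (1, y) = f (0, y) := by simpa using hf1 (0, y)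
  have e2 (y : ℝ) : g (y, 1) = g (y, 0) := by simpa using hg2 (y, 0)
  refine key.trans ?_
  simp [e1, e2]

lemma integral_unitSquare_eq_iterated {f : ℝ × ℝ → ℝ} (hf : Continuous f) :
    ∫ x in unitSquare, f x = ∫ s in (0 : ℝ)..1, ∫ t in (0 : ℝ)..1, f (t, s) := by
  have hi : IntegrableOn f (Set.Icc (0 : ℝ) 1 ×ˢ Set.Icc (0 : ℝ) 1) (volume.prod volume) := by
    have := hf.integrableOn_unitSquare
    rwa [unitSquare, ← Set.Icc_prod_Icc, Measure.volume_eq_prod] at this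
  rw [unitSquare, ← Set.Icc_prod_Icc, Measure.volume_eq_prod, ← setIntegral_prod_swap]
  rw [setIntegral_prod (fun z : ℝ × ℝ => f z.swap) hi.swap, integral_Icc_eq_integral_Ioc,
    intervalIntegral.integral_of_le zero_le_one]
  refine setIntegral_congr_fun measurableSet_Ioc fun s _ => ?_
  simp only [Prod.swap_prod_mk]
  rw [integral_Icc_eq_integral_Ioc, intervalIntegral.integral_of_le zero_le_one]

lemma integral_unitSquare_pos {f : ℝ × ℝ → ℝ} (hf : Continuous f) (h0 : ∀ x, 0 ≤ f x)
    (hpos : 0 < f (0, 0)) : 0 < ∫ x in unitSquare, f x := by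
  rw [setIntegral_pos_iff_support_of_nonneg_ae (Filter.Eventually.of_forall h0)
    hf.integrableOn_unitSquare]
  have hU : IsOpen (Function.support f) := hf.isOpen_support
  have hcl : ((0 : ℝ), (0 : ℝ)) ∈ closure (Set.Ioo (0 : ℝ) 1 ×ˢ Set.Ioo (0 : ℝ) 1) := by
    rw [closure_prod_eq, closure_Ioo zero_ne_one]
    simp
  have hne : (Function.support f ∩ Set.Ioo (0 : ℝ) 1 ×ˢ Set.Ioo (0 : ℝ) 1).Nonempty :=
    mem_closure_iff.1 hcl _ hU hpos.ne'
  refine ((hU.inter (isOpen_Ioo.prod isOpen_Ioo)).measure_pos volume hne).trans_le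
    (measure_mono (Set.inter_subset_inter_right _ ?_))
  rw [unitSquare, ← Set.Icc_prod_Icc]
  exact Set.prod_mono Set.Ioo_subset_Icc_self Set.Ioo_subset_Icc_self

/-! ### Smoothness of parametric primitives -/

lemma hasFDerivAt_parametric_integral {E F : Type*} [NormedAddCommGroup E] [NormedSpace ℝ E]
    [ProperSpace E] [NormedAddCommGroup F] [NormedSpace ℝ F] {g : E × ℝ → F}
    (hg : ContDiff ℝ 1 g) (x : E) :
    HasFDerivAt (fun y => ∫ t in (0 : ℝ)..1, g (y, t))
      (∫ t in (0 : ℝ)..1, (fderiv ℝ g (x, t)).comp (ContinuousLinearMap.inl ℝ E ℝ)) x := by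
  have hc : Continuous fun p : E × ℝ => (fderiv ℝ g p).comp (ContinuousLinearMap.inl ℝ E ℝ) :=
    (hg.continuous_fderiv (by simp)).clm_comp continuous_const
  obtain ⟨C, hC⟩ :=
    ((isCompact_closedBall x 1).prod
      (isCompact_Icc (a := (0 : ℝ)) (b := 1))).exists_bound_of_continuousOn hc.continuousOn
  refine intervalIntegral.hasFDerivAt_integral_of_dominated_of_fderiv_le
    (F := fun y t => g (y, t))
    (F' := fun y t => (fderiv ℝ g (y, t)).comp (ContinuousLinearMap.inl ℝ E ℝ))
    (bound := fun _ => C) (Metric.closedBall_mem_nhds x one_pos) ?_ ?_ ?_ ?_ ?_ ?_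
  · exact Filter.Eventually.of_forall fun y =>
      (hg.continuous.comp (by fun_prop : Continuous fun t : ℝ => (y, t))).aestronglyMeasurable
  · exact (hg.continuous.comp
      (by fun_prop : Continuous fun t : ℝ => (x, t))).intervalIntegrable _ _
  · exact (hc.comp (by fun_prop : Continuous fun t : ℝ => (x, t))).aestronglyMeasurable
  · refine Filter.Eventually.of_forall fun t ht y hy => hC (y, t) ⟨hy, ?_⟩
    rw [Set.uIoc_of_le zero_le_one] at ht
    exact ⟨ht.1.le, ht.2⟩
  · exact intervalIntegrable_const
  · refine Filter.Eventually.of_forall fun t _ y _ => ?_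
    have h1 : HasFDerivAt (fun y : E => (y, t)) (ContinuousLinearMap.inl ℝ E ℝ) y :=
      hasFDerivAt_prodMk_left y t
    exact (((hg.differentiable (by simp)) (y, t)).hasFDerivAt).comp y h1

lemma contDiff_parametric_integral {E : Type} [NormedAddCommGroup E] [NormedSpace ℝ E]
    [ProperSpace E] (n : ℕ) : ∀ {F : Type} [NormedAddCommGroup F] [NormedSpace ℝ F]
      {g : E × ℝ → F}, ContDiff ℝ (⊤ : ℕ∞) g →
      ContDiff ℝ n (fun x => ∫ t in (0 : ℝ)..1, g (x, t)) := by
  induction n with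
  | zero =>
    intro F _ _ g hg
    exact contDiff_zero.2 <| continuous_iff_continuousAt.2 fun x =>
      (hasFDerivAt_parametric_integral (hg.of_le (by exact_mod_cast le_top)) x).continuousAt
  | succ n ih =>
    intro F _ _ g hg
    have h := hasFDerivAt_parametric_integral (hg.of_le (m := 1) (by exact_mod_cast le_top))
    refine contDiff_succ_iff_hasFDerivAt.2 ⟨_, ih (g := fun p : E × ℝ =>
      (fderiv ℝ g p).comp (ContinuousLinearMap.inl ℝ E ℝ)) ?_, h⟩
    exact (hg.fderiv_right (m := (⊤ : ℕ∞)) (by simp)).clm_comp contDiff_const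

lemma contDiff_primitive {g : ℝ × ℝ → ℝ} (hg : ContDiff ℝ (⊤ : ℕ∞) g) :
    ContDiff ℝ (⊤ : ℕ∞) (fun x : ℝ × ℝ => ∫ t in (0 : ℝ)..x.1, g (t, x.2)) := by
  have e (x : ℝ × ℝ) : ∫ t in (0 : ℝ)..x.1, g (t, x.2) =
      x.1 * ∫ t in (0 : ℝ)..1, g (x.1 * t, x.2) := by
    simpa using (intervalIntegral.mul_integral_comp_mul_left (f := fun t => g (t, x.2))
      (a := 0) (b := 1) x.1).symm
  simp_rw [e]
  refine contDiff_fst.mul (contDiff_infty.2 fun n => ?_)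
  exact contDiff_parametric_integral n
    (g := fun p : (ℝ × ℝ) × ℝ => g (p.1.1 * p.2, p.1.2)) (hg.comp (by fun_prop))
/-! ### The Bogomolny identity -/

section Bogomolny

variable {a1 a2 : ℝ × ℝ → ℝ} {φ : ℝ × ℝ → ℂ}

lemma contDiff_D1 (ha : ContDiff ℝ (⊤ : ℕ∞) a1) (hφ : ContDiff ℝ (⊤ : ℕ∞) φ) :
    ContDiff ℝ (⊤ : ℕ∞) (D1 a1 φ) :=
  (contDiff_pd1 hφ).add ((contDiff_const.mul (ofRealCLM.contDiff.comp ha)).mul hφ)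

lemma contDiff_D2 (ha : ContDiff ℝ (⊤ : ℕ∞) a2) (hφ : ContDiff ℝ (⊤ : ℕ∞) φ) :
    ContDiff ℝ (⊤ : ℕ∞) (D2 a2 φ) :=
  (contDiff_pd2 hφ).add ((contDiff_const.mul (ofRealCLM.contDiff.comp ha)).mul hφ)

lemma pd1_D2 (ha : ContDiff ℝ (⊤ : ℕ∞) a2) (hφ : ContDiff ℝ (⊤ : ℕ∞) φ) (x : ℝ × ℝ) :
    pd1 (D2 a2 φ) x = pd1 (pd2 φ) x + I * (pd1 a2 x * φ x + a2 x * pd1 φ x) := by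
  have h1 : DifferentiableAt ℝ (fun y => (a2 y : ℂ)) x :=
    (ofRealCLM.contDiff.comp ha).differentiable_top x
  have h2 : DifferentiableAt ℝ (fun _ : ℝ × ℝ => I) x := differentiableAt_const _
  have h3 : pd1 (fun y => (a2 y : ℂ)) x = pd1 a2 x :=
    pd1_clm ofRealCLM (ha.differentiable_top x)
  have h4 : pd1 (fun _ : ℝ × ℝ => I) x = 0 := by simp [pd1]
  have h := hφ.differentiable_top x
  unfold D2
  rw [pd1_add ((contDiff_pd2 hφ).differentiable_top x) ((h2.fun_mul h1).fun_mul h),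
    pd1_mul (h2.fun_mul h1) h,
    pd1_mul h2 h1, h3, h4]
  ring

lemma pd2_D1 (ha : ContDiff ℝ (⊤ : ℕ∞) a1) (hφ : ContDiff ℝ (⊤ : ℕ∞) φ) (x : ℝ × ℝ) :
    pd2 (D1 a1 φ) x = pd1 (pd2 φ) x + I * (pd2 a1 x * φ x + a1 x * pd2 φ x) := by
  have h1 : DifferentiableAt ℝ (fun y => (a1 y : ℂ)) x :=
    (ofRealCLM.contDiff.comp ha).differentiable_top x
  have h2 : DifferentiableAt ℝ (fun _ : ℝ × ℝ => I) x := differentiableAt_const _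
  have h3 : pd2 (fun y => (a1 y : ℂ)) x = pd2 a1 x :=
    pd2_clm ofRealCLM (ha.differentiable_top x)
  have h4 : pd2 (fun _ : ℝ × ℝ => I) x = 0 := by simp [pd2]
  have h := hφ.differentiable_top x
  unfold D1
  rw [pd2_add ((contDiff_pd1 hφ).differentiable_top x) ((h2.fun_mul h1).fun_mul h),
    pd2_mul (h2.fun_mul h1) h,
    pd2_mul h2 h1, h3, h4, pd1_pd2_comm hφ]
  ring

/-- The current `Im (φ · conj ψ)`. -/
def current (φ ψ : ℝ × ℝ → ℂ) : ℝ × ℝ → ℝ :=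
  fun x => (φ x * (starRingEnd ℂ) (ψ x)).im

lemma contDiff_current {ψ : ℝ × ℝ → ℂ} (hφ : ContDiff ℝ (⊤ : ℕ∞) φ)
    (hψ : ContDiff ℝ (⊤ : ℕ∞) ψ) : ContDiff ℝ (⊤ : ℕ∞) (current φ ψ) :=
  imCLM.contDiff.comp (hφ.mul (conjCLE.contDiff.comp hψ))

lemma pd1_current {ψ : ℝ × ℝ → ℂ} {x : ℝ × ℝ} (hφ : ContDiff ℝ (⊤ : ℕ∞) φ)
    (hψ : ContDiff ℝ (⊤ : ℕ∞) ψ) : pd1 (current φ ψ) x =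
      (pd1 φ x * (starRingEnd ℂ) (ψ x) + φ x * (starRingEnd ℂ) (pd1 ψ x)).im := by
  have h1 := hφ.differentiable_top x
  have h2 : DifferentiableAt ℝ (fun y => (starRingEnd ℂ) (ψ y)) x :=
    (conjCLE.contDiff.comp hψ).differentiable_top x
  have h3 : pd1 (fun y => (starRingEnd ℂ) (ψ y)) x = (starRingEnd ℂ) (pd1 ψ x) :=
    pd1_clm conjCLE.toContinuousLinearMap (hψ.differentiable_top x)
  have h := pd1_clm imCLM (h1.mul h2)
  rw [← h3, ← pd1_mul h1 h2]
  exact h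

lemma pd2_current {ψ : ℝ × ℝ → ℂ} {x : ℝ × ℝ} (hφ : ContDiff ℝ (⊤ : ℕ∞) φ)
    (hψ : ContDiff ℝ (⊤ : ℕ∞) ψ) : pd2 (current φ ψ) x =
      (pd2 φ x * (starRingEnd ℂ) (ψ x) + φ x * (starRingEnd ℂ) (pd2 ψ x)).im := by
  have h1 := hφ.differentiable_top x
  have h2 : DifferentiableAt ℝ (fun y => (starRingEnd ℂ) (ψ y)) x :=
    (conjCLE.contDiff.comp hψ).differentiable_top x
  have h3 : pd2 (fun y => (starRingEnd ℂ) (ψ y)) x = (starRingEnd ℂ) (pd2 ψ x) :=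
    pd2_clm conjCLE.toContinuousLinearMap (hψ.differentiable_top x)
  have h := pd2_clm imCLM (h1.mul h2)
  rw [← h3, ← pd2_mul h1 h2]
  exact h

lemma two_im_D1_conj_D2 (ha1 : ContDiff ℝ (⊤ : ℕ∞) a1) (ha2 : ContDiff ℝ (⊤ : ℕ∞) a2)
    (hφ : ContDiff ℝ (⊤ : ℕ∞) φ) (x : ℝ × ℝ) :
    2 * (D1 a1 φ x * (starRingEnd ℂ) (D2 a2 φ x)).im = curv a1 a2 x * ‖φ x‖ ^ 2 +
      (pd1 (current φ (D2 a2 φ)) x + pd2 (fun y => -current φ (D1 a1 φ) y) x) := by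
  rw [pd2_neg, pd1_current hφ (contDiff_D2 ha2 hφ), pd2_current hφ (contDiff_D1 ha1 hφ),
    pd1_D2 ha2 hφ, pd2_D1 ha1 hφ, ← normSq_eq_norm_sq, normSq_apply]
  simp only [D1, D2, curv, mul_im, mul_re, add_re, add_im, conj_re, conj_im, I_re, I_im,
    ofReal_re, ofReal_im]
  ring

lemma normSq_D1_sub (z w : ℂ) :
    ‖z‖ ^ 2 + ‖w‖ ^ 2 = ‖z - I * w‖ ^ 2 + 2 * (z * (starRingEnd ℂ) w).im := by
  simp only [← normSq_eq_norm_sq, normSq_apply, sub_re, sub_im, mul_re, mul_im, I_re, I_im,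
    conj_re, conj_im]
  ring

lemma abs_two_im_mul_conj_le (z w : ℂ) :
    |2 * (z * (starRingEnd ℂ) w).im| ≤ ‖z‖ ^ 2 + ‖w‖ ^ 2 := by
  have h := abs_im_le_norm (z * (starRingEnd ℂ) w)
  rw [norm_mul, norm_conj] at h
  rw [abs_mul, abs_two]
  nlinarith [sq_nonneg (‖z‖ - ‖w‖)]

end Bogomolny

namespace FieldPair

variable {d : ℤ} (P : FieldPair d)

lemma norm_gauge (d : ℤ) (t : ℝ) :
    ‖Complex.exp (2 * Real.pi * Complex.I * (d : ℂ) * (t : ℂ))‖ = 1 := by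
  have : (2 * Real.pi * Complex.I * (d : ℂ) * (t : ℂ)) = ((2 * Real.pi * d * t : ℝ) : ℂ) * I := by
    push_cast; ring
  rw [this, norm_exp_ofReal_mul_I]

lemma pd1_gauge (d : ℤ) (x : ℝ × ℝ) :
    pd1 (fun y : ℝ × ℝ => Complex.exp (2 * Real.pi * Complex.I * (d : ℂ) * (y.1 : ℂ))) x =
      2 * Real.pi * Complex.I * d *
        Complex.exp (2 * Real.pi * Complex.I * (d : ℂ) * (x.1 : ℂ)) := by
  have h1 : HasFDerivAt (fun y : ℝ × ℝ => (y.1 : ℂ))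
      (ofRealCLM.comp (ContinuousLinearMap.fst ℝ ℝ ℝ)) x :=
    (ofRealCLM.comp (ContinuousLinearMap.fst ℝ ℝ ℝ)).hasFDerivAt
  have h2 := (h1.const_mul (2 * Real.pi * Complex.I * (d : ℂ))).cexp
  rw [pd1_eq_of_hasFDerivAt h2]
  simp
  ring

lemma D2_shift1 (x : ℝ × ℝ) : D2 P.a2 P.φ (x.1 + 1, x.2) = D2 P.a2 P.φ x := by
  simp only [D2, P.per1_a2, P.per1_φ, pd2, ← fderiv_shift1 (f := P.φ)]

lemma D1_shift2 (x : ℝ × ℝ) : D1 P.a1 P.φ (x.1, x.2 + 1) =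
    Complex.exp (2 * Real.pi * Complex.I * (d : ℂ) * (x.1 : ℂ)) * D1 P.a1 P.φ x := by
  have h : pd1 P.φ (x.1, x.2 + 1) = pd1 (fun y : ℝ × ℝ =>
      Complex.exp (2 * Real.pi * Complex.I * (d : ℂ) * (y.1 : ℂ)) * P.φ y) x := by
    simp only [← P.per2_φ, pd1, fderiv_shift2]
  rw [pd1_mul (by fun_prop) (P.smooth_φ.differentiable_top x), pd1_gauge] at h
  simp only [D1, P.per2_a1, P.per2_φ, h]
  push_cast
  ring

lemma integral_two_im : ∫ x in unitSquare,
      2 * (D1 P.a1 P.φ x * (starRingEnd ℂ) (D2 P.a2 P.φ x)).im =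
    ∫ x in unitSquare, curv P.a1 P.a2 x * ‖P.φ x‖ ^ 2 := by
  simp_rw [two_im_D1_conj_D2 P.smooth_a1 P.smooth_a2 P.smooth_φ]
  have hJ2 := contDiff_current P.smooth_φ (contDiff_D2 P.smooth_a2 P.smooth_φ)
  have hJ1 := (contDiff_current P.smooth_φ (contDiff_D1 P.smooth_a1 P.smooth_φ)).neg
  have hc : Continuous (curv P.a1 P.a2) :=
    (contDiff_pd1 P.smooth_a2).continuous.sub (contDiff_pd2 P.smooth_a1).continuous
  have hi1 : IntegrableOn (fun x => curv P.a1 P.a2 x * ‖P.φ x‖ ^ 2) unitSquare :=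
    (hc.mul (P.smooth_φ.continuous.norm.pow 2)).integrableOn_unitSquare
  have hi2 : IntegrableOn (fun x => pd1 (current P.φ (D2 P.a2 P.φ)) x +
      pd2 (fun y => -current P.φ (D1 P.a1 P.φ) y) x) unitSquare :=
    ((contDiff_pd1 hJ2).continuous.add (contDiff_pd2 hJ1).continuous).integrableOn_unitSquare
  rw [integral_add hi1 hi2, integral_divergence_unitSquare hJ2 hJ1, add_zero]
  · intro x
    simp only [current, P.D2_shift1, P.per1_φ]
  · intro x
    simp only [current, P.D1_shift2, P.per2_φ, map_mul]
    have h : Complex.exp (2 * Real.pi * Complex.I * (d : ℂ) * (x.1 : ℂ)) * (starRingEnd ℂ)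
        (Complex.exp (2 * Real.pi * Complex.I * (d : ℂ) * (x.1 : ℂ))) = 1 := by
      rw [mul_conj, normSq_eq_norm_sq, norm_gauge]; simp
    rw [mul_mul_mul_comm, h, one_mul]

/-- The Dirichlet energy of the section. -/
def dirichlet : ℝ := ∫ x in unitSquare, (‖D1 P.a1 P.φ x‖ ^ 2 + ‖D2 P.a2 P.φ x‖ ^ 2)

lemma continuous_D1 : Continuous (D1 P.a1 P.φ) := (contDiff_D1 P.smooth_a1 P.smooth_φ).continuous

lemma continuous_D2 : Continuous (D2 P.a2 P.φ) := (contDiff_D2 P.smooth_a2 P.smooth_φ).continuous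

lemma continuous_two_im :
    Continuous fun x => 2 * (D1 P.a1 P.φ x * (starRingEnd ℂ) (D2 P.a2 P.φ x)).im :=
  continuous_const.mul (continuous_im.comp
    (P.continuous_D1.mul (continuous_conj.comp P.continuous_D2)))

/-- The Bogomolny identity. -/
lemma dirichlet_eq : P.dirichlet =
    (∫ x in unitSquare, ‖D1 P.a1 P.φ x - I * D2 P.a2 P.φ x‖ ^ 2) +
      ∫ x in unitSquare, curv P.a1 P.a2 x * ‖P.φ x‖ ^ 2 := by
  rw [← P.integral_two_im, ← integral_add _ P.continuous_two_im.integrableOn_unitSquare]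
  · simp only [dirichlet, ← normSq_D1_sub]
  · exact ((P.continuous_D1.sub
      (continuous_const.mul P.continuous_D2)).norm.pow 2).integrableOn_unitSquare

lemma abs_integral_curv_le :
    |∫ x in unitSquare, curv P.a1 P.a2 x * ‖P.φ x‖ ^ 2| ≤ P.dirichlet := by
  rw [← P.integral_two_im]
  refine abs_integral_le_integral_abs.trans (integral_mono ?_ ?_ fun x => ?_)
  · exact P.continuous_two_im.abs.integrableOn_unitSquare
  · exact ((P.continuous_D1.norm.pow 2).add (P.continuous_D2.norm.pow 2)).integrableOn_unitSquare
  · exact abs_two_im_mul_conj_le _ _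

lemma dirichlet_nonneg : 0 ≤ P.dirichlet := (abs_nonneg _).trans P.abs_integral_curv_le

end FieldPair
/-! ### Approximate solution of the Poisson equation on the torus -/

/-- The flat Laplacian on the plane. -/
def laplacian {E : Type*} [NormedAddCommGroup E] [NormedSpace ℝ E]
    (u : ℝ × ℝ → E) (x : ℝ × ℝ) : E :=
  pd1 (pd1 u) x + pd2 (pd2 u) x

section Laplacian

variable {E : Type*} [NormedAddCommGroup E] [NormedSpace ℝ E] {u v : ℝ × ℝ → E}

lemma laplacian_add (hu : ContDiff ℝ (⊤ : ℕ∞) u) (hv : ContDiff ℝ (⊤ : ℕ∞) v) (x : ℝ × ℝ) :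
    laplacian (fun y => u y + v y) x = laplacian u x + laplacian v x := by
  have h1 : pd1 (fun y => u y + v y) = fun y => pd1 u y + pd1 v y :=
    funext fun y => pd1_add (hu.differentiable_top y) (hv.differentiable_top y)
  have h2 : pd2 (fun y => u y + v y) = fun y => pd2 u y + pd2 v y :=
    funext fun y => pd2_add (hu.differentiable_top y) (hv.differentiable_top y)
  rw [laplacian, h1, h2, pd1_add ((contDiff_pd1 hu).differentiable_top x)
    ((contDiff_pd1 hv).differentiable_top x), pd2_add ((contDiff_pd2 hu).differentiable_top x)
    ((contDiff_pd2 hv).differentiable_top x), laplacian, laplacian]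
  abel

lemma laplacian_clm {G : Type*} [NormedAddCommGroup G] [NormedSpace ℝ G] (T : E →L[ℝ] G)
    (hu : ContDiff ℝ (⊤ : ℕ∞) u) (x : ℝ × ℝ) :
    laplacian (fun y => T (u y)) x = T (laplacian u x) := by
  have h1 : pd1 (fun y => T (u y)) = fun y => T (pd1 u y) :=
    funext fun y => pd1_clm T (hu.differentiable_top y)
  have h2 : pd2 (fun y => T (u y)) = fun y => T (pd2 u y) :=
    funext fun y => pd2_clm T (hu.differentiable_top y)
  rw [laplacian, h1, h2, pd1_clm T ((contDiff_pd1 hu).differentiable_top x),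
    pd2_clm T ((contDiff_pd2 hu).differentiable_top x), laplacian, map_add]

lemma laplacian_zero (x : ℝ × ℝ) : laplacian (fun _ => (0 : E)) x = 0 := by
  have h1 : pd1 (fun _ : ℝ × ℝ => (0 : E)) = fun _ => 0 := funext fun y => by simp [pd1]
  have h2 : pd2 (fun _ : ℝ × ℝ => (0 : E)) = fun _ => 0 := funext fun y => by simp [pd2]
  rw [laplacian, h1, h2, h1, h2, add_zero]

lemma contDiff_laplacian (hu : ContDiff ℝ (⊤ : ℕ∞) u) : ContDiff ℝ (⊤ : ℕ∞) (laplacian u) :=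
  (contDiff_pd1 (contDiff_pd1 hu)).add (contDiff_pd2 (contDiff_pd2 hu))

lemma TorusPeriodic.laplacian (hu : TorusPeriodic u) : TorusPeriodic (laplacian u) :=
  ⟨fun x => congrArg₂ (· + ·) (hu.pd1.pd1.1 x) (hu.pd2.pd2.1 x),
    fun x => congrArg₂ (· + ·) (hu.pd1.pd1.2 x) (hu.pd2.pd2.2 x)⟩

lemma integral_laplacian {u : ℝ × ℝ → ℝ} (hu : ContDiff ℝ (⊤ : ℕ∞) u) (hp : TorusPeriodic u) :
    ∫ x in unitSquare, laplacian u x = 0 :=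
  integral_divergence_unitSquare (contDiff_pd1 hu) (contDiff_pd2 hu) hp.pd1.1 hp.pd2.2

end Laplacian

/-- The character `exp (2πi (m x₁ + n x₂))`. -/
def planeWave (m n : ℤ) (x : ℝ × ℝ) : ℂ :=
  Complex.exp (2 * Real.pi * I * m * (x.1 : ℂ) + 2 * Real.pi * I * n * (x.2 : ℂ))

lemma hasFDerivAt_planeWave (m n : ℤ) (x : ℝ × ℝ) :
    HasFDerivAt (planeWave m n) (planeWave m n x •
      ((2 * Real.pi * I * m : ℂ) • (ofRealCLM.comp (ContinuousLinearMap.fst ℝ ℝ ℝ)) +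
        (2 * Real.pi * I * n : ℂ) • (ofRealCLM.comp (ContinuousLinearMap.snd ℝ ℝ ℝ)))) x :=
  (((ofRealCLM.comp (ContinuousLinearMap.fst ℝ ℝ ℝ)).hasFDerivAt.const_mul
    (2 * Real.pi * I * m : ℂ)).add
    ((ofRealCLM.comp (ContinuousLinearMap.snd ℝ ℝ ℝ)).hasFDerivAt.const_mul
    (2 * Real.pi * I * n : ℂ))).cexp

lemma contDiff_planeWave (m n : ℤ) : ContDiff ℝ (⊤ : ℕ∞) (planeWave m n) := by
  have h1 : ContDiff ℝ (⊤ : ℕ∞) fun x : ℝ × ℝ => (x.1 : ℂ) := ofRealCLM.contDiff.comp contDiff_fst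
  have h2 : ContDiff ℝ (⊤ : ℕ∞) fun x : ℝ × ℝ => (x.2 : ℂ) := ofRealCLM.contDiff.comp contDiff_snd
  exact ((contDiff_const.mul h1).add (contDiff_const.mul h2)).cexp

lemma torusPeriodic_planeWave (m n : ℤ) : TorusPeriodic (planeWave m n) := by
  constructor <;> intro x <;> simp only [planeWave, Complex.exp_eq_exp_iff_exists_int]
  · exact ⟨m, by push_cast; ring⟩
  · exact ⟨n, by push_cast; ring⟩

lemma laplacian_planeWave (m n : ℤ) (x : ℝ × ℝ) : laplacian (planeWave m n) x =
    -(4 * Real.pi ^ 2 * (m ^ 2 + n ^ 2)) * planeWave m n x := by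
  have h1 : pd1 (planeWave m n) = fun y => (2 * Real.pi * I * m) * planeWave m n y := by
    funext y
    rw [pd1_eq_of_hasFDerivAt (hasFDerivAt_planeWave m n y)]
    simp
    ring
  have h2 : pd2 (planeWave m n) = fun y => (2 * Real.pi * I * n) * planeWave m n y := by
    funext y
    rw [pd2_eq_of_hasFDerivAt (hasFDerivAt_planeWave m n y)]
    simp
    ring
  have h3 (c : ℂ) : pd1 (fun y => c * planeWave m n y) x = c * pd1 (planeWave m n) x :=
    pd1_clm (ContinuousLinearMap.mul ℝ ℂ c) ((contDiff_planeWave m n).differentiable_top x)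
  have h4 (c : ℂ) : pd2 (fun y => c * planeWave m n y) x = c * pd2 (planeWave m n) x :=
    pd2_clm (ContinuousLinearMap.mul ℝ ℂ c) ((contDiff_planeWave m n).differentiable_top x)
  rw [laplacian, h1, h2, h3, h4, h1, h2]
  ring_nf
  simp only [I_sq]
  ring

/-- The covering projection from the plane to the torus. -/
def toTorus (x : ℝ × ℝ) : UnitAddTorus (Fin 2) := Pi.map (fun _ => (↑)) ![x.1, x.2]

lemma mFourier_toTorus (n : Fin 2 → ℤ) (x : ℝ × ℝ) :
    UnitAddTorus.mFourier n (toTorus x) = planeWave (n 0) (n 1) x := by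
  simp only [UnitAddTorus.mFourier, toTorus, ContinuousMap.coe_mk, Fin.prod_univ_two, Pi.map_apply,
    planeWave, Complex.exp_add]
  simp

lemma TorusPeriodic.add_int {E : Type*} {f : ℝ × ℝ → E} (hf : TorusPeriodic f) (s t : ℝ)
    (m n : ℤ) : f (s + m, t + n) = f (s, t) := by
  have h1 : Function.Periodic (fun s => f (s, t + n)) 1 := fun s => hf.1 (s, t + n)
  have h2 : Function.Periodic (fun t => f (s, t)) 1 := fun t => hf.2 (s, t)
  have e1 := h1.int_mul m s
  have e2 := h2.int_mul n t
  simp only [mul_one] at e1 e2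
  rw [e1, e2]

lemma TorusPeriodic.exists_descent {f : ℝ × ℝ → ℂ} (hf : TorusPeriodic f) (hc : Continuous f) :
    ∃ p : C(UnitAddTorus (Fin 2), ℂ), ∀ x, p (toTorus x) = f x := by
  have hq : IsOpenQuotientMap (Pi.map fun _ => (↑) : (Fin 2 → ℝ) → Fin 2 → UnitAddCircle) :=
    .piMap fun _ => QuotientAddGroup.isOpenQuotientMap_mk
  have key (y z : Fin 2 → ℝ) (h : (Pi.map fun _ => (↑) : (Fin 2 → ℝ) → Fin 2 → UnitAddCircle) y =
      (Pi.map fun _ => (↑)) z) : f (y 0, y 1) = f (z 0, z 1) := by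
    have hi (i : Fin 2) : ∃ n : ℤ, z i = y i + n := by
      have h1 : ((z i - y i : ℝ) : UnitAddCircle) = 0 := by
        rw [AddCircle.coe_sub, sub_eq_zero]
        exact (congrFun h i).symm
      obtain ⟨n, hn⟩ := AddCircle.coe_eq_zero_iff (p := (1 : ℝ)) |>.1 h1
      exact ⟨n, by simp at hn; linarith⟩
    obtain ⟨m, hm⟩ := hi 0
    obtain ⟨n, hn⟩ := hi 1
    rw [hm, hn, hf.add_int]
  let g : (Fin 2 → ℝ) → ℂ := fun y => f (y 0, y 1)
  have hcomp : (g ∘ Function.surjInv hq.surjective) ∘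
      (Pi.map fun _ => (↑) : (Fin 2 → ℝ) → Fin 2 → UnitAddCircle) = g :=
    funext fun y => key _ _ (Function.surjInv_eq hq.surjective _)
  refine ⟨⟨g ∘ Function.surjInv hq.surjective, ?_⟩, fun x => ?_⟩
  · rw [hq.isQuotientMap.continuous_iff, hcomp]
    exact hc.comp (by fun_prop)
  · exact congrFun hcomp ![x.1, x.2]

lemma exists_laplacian_of_mem_span {p : C(UnitAddTorus (Fin 2), ℂ)}
    (hp : p ∈ Submodule.span ℂ (Set.range (UnitAddTorus.mFourier (d := Fin 2)))) :
    ∃ u : ℝ × ℝ → ℂ, ContDiff ℝ (⊤ : ℕ∞) u ∧ TorusPeriodic u ∧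
      ∃ c : ℂ, ∀ x, p (toTorus x) = laplacian u x + c := by
  induction hp using Submodule.span_induction with
  | mem p hp =>
    obtain ⟨n, rfl⟩ := hp
    by_cases hn : n 0 = 0 ∧ n 1 = 0
    · refine ⟨fun _ => 0, contDiff_const, ⟨fun _ => rfl, fun _ => rfl⟩, 1, fun x => ?_⟩
      rw [mFourier_toTorus, hn.1, hn.2]
      simp [planeWave, laplacian_zero]
    · have h0 : (-(4 * Real.pi ^ 2 * ((n 0) ^ 2 + (n 1) ^ 2)) : ℂ) ≠ 0 := by
        have h1 : (0 : ℤ) < n 0 ^ 2 + n 1 ^ 2 := by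
          rcases not_and_or.1 hn with h | h <;> positivity
        have h2 : ((n 0 ^ 2 + n 1 ^ 2 : ℤ) : ℂ) ≠ 0 := Int.cast_ne_zero.2 h1.ne'
        push_cast at h2
        simp [h2, Real.pi_ne_zero]
      refine ⟨fun x => ContinuousLinearMap.mul ℝ ℂ
        (-(4 * Real.pi ^ 2 * ((n 0) ^ 2 + (n 1) ^ 2)) : ℂ)⁻¹ (planeWave (n 0) (n 1) x),
        (ContinuousLinearMap.contDiff _).comp (contDiff_planeWave _ _), ?_, 0, fun x => ?_⟩
      · exact ⟨fun x => congrArg _ ((torusPeriodic_planeWave _ _).1 x),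
          fun x => congrArg _ ((torusPeriodic_planeWave _ _).2 x)⟩
      · rw [laplacian_clm _ (contDiff_planeWave _ _), laplacian_planeWave, mFourier_toTorus,
          ContinuousLinearMap.mul_apply', inv_mul_cancel_left₀ h0, add_zero]
  | zero =>
    refine ⟨fun _ => 0, contDiff_const, ⟨fun _ => rfl, fun _ => rfl⟩, 0, fun x => ?_⟩
    simp [laplacian_zero]
  | add p q _ _ hp hq =>
    obtain ⟨u, hu, hup, c, hc⟩ := hp
    obtain ⟨v, hv, hvp, e, he⟩ := hq
    refine ⟨fun x => u x + v x, hu.add hv, ⟨fun x => ?_, fun x => ?_⟩, c + e, fun x => ?_⟩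
    · simp only [hup.1, hvp.1]
    · simp only [hup.2, hvp.2]
    · rw [laplacian_add hu hv, ContinuousMap.add_apply, hc, he]
      ring
  | smul z p _ hp =>
    obtain ⟨u, hu, hup, c, hc⟩ := hp
    refine ⟨fun x => ContinuousLinearMap.mul ℝ ℂ z (u x),
      (ContinuousLinearMap.contDiff _).comp hu, ⟨fun x => congrArg _ (hup.1 x),
        fun x => congrArg _ (hup.2 x)⟩, z * c, fun x => ?_⟩
    rw [laplacian_clm _ hu, ContinuousMap.smul_apply, hc, ContinuousLinearMap.mul_apply']
    simp only [smul_eq_mul]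
    ring

lemma exists_laplacian_approx {f : ℝ × ℝ → ℝ} (hc : Continuous f) (hf : TorusPeriodic f) {ε : ℝ}
    (hε : 0 < ε) : ∃ u : ℝ × ℝ → ℝ, ContDiff ℝ (⊤ : ℕ∞) u ∧ TorusPeriodic u ∧
      ∃ c : ℝ, ∀ x, |f x - (laplacian u x + c)| ≤ ε := by
  obtain ⟨p, hp⟩ := TorusPeriodic.exists_descent (f := fun x => (f x : ℂ))
    ⟨fun x => congrArg _ (hf.1 x), fun x => congrArg _ (hf.2 x)⟩ (continuous_ofReal.comp hc)
  have hmem : p ∈ closure (Submodule.span ℂ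
      (Set.range (UnitAddTorus.mFourier (d := Fin 2))) : Set C(UnitAddTorus (Fin 2), ℂ)) := by
    rw [← Submodule.topologicalClosure_coe, UnitAddTorus.span_mFourier_closure_eq_top]
    trivial
  obtain ⟨q, hq, hpq⟩ := Metric.mem_closure_iff.1 hmem ε hε
  obtain ⟨u, hu, hup, c, huc⟩ := exists_laplacian_of_mem_span hq
  refine ⟨fun x => reCLM (u x), reCLM.contDiff.comp hu, ⟨fun x => congrArg _ (hup.1 x),
    fun x => congrArg _ (hup.2 x)⟩, c.re, fun x => ?_⟩
  have h1 : ‖p (toTorus x) - q (toTorus x)‖ ≤ ε :=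
    (dist_eq_norm (p (toTorus x)) _ ▸ ContinuousMap.dist_apply_le_dist _).trans hpq.le
  rw [hp, huc] at h1
  rw [laplacian_clm reCLM hu]
  simpa using (abs_re_le_norm _).trans h1

/-! ### Potentials of small curvature -/

lemma exists_potential {G : ℝ × ℝ → ℝ} (hG : ContDiff ℝ (⊤ : ℕ∞) G) (hp : TorusPeriodic G)
    (h0 : ∫ x in unitSquare, G x = 0) {δ : ℝ} (hδ : ∀ x, |G x| ≤ δ) :
    ∃ c1 c2 : ℝ × ℝ → ℝ, ContDiff ℝ (⊤ : ℕ∞) c1 ∧ ContDiff ℝ (⊤ : ℕ∞) c2 ∧ TorusPeriodic c1 ∧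
      TorusPeriodic c2 ∧ (∀ x, curv c1 c2 x = G x) ∧
      ∀ x ∈ unitSquare, c1 x ^ 2 + c2 x ^ 2 ≤ 5 * δ ^ 2 := by
  set R : ℝ × ℝ → ℝ := fun x => ∫ t in (0 : ℝ)..x.1, G (t, x.2) with hR
  have hRs : ContDiff ℝ (⊤ : ℕ∞) R := contDiff_primitive hG
  set m : ℝ → ℝ := fun s => R (1, s) with hm
  have hms : ContDiff ℝ (⊤ : ℕ∞) m := hRs.comp (by fun_prop)
  set N : ℝ → ℝ := fun s => ∫ t in (0 : ℝ)..s, m t with hN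
  have hNs : ContDiff ℝ (⊤ : ℕ∞) N :=
    (contDiff_primitive (g := fun x : ℝ × ℝ => m x.1) (hms.comp contDiff_fst)).comp
      (by fun_prop : ContDiff ℝ (⊤ : ℕ∞) fun s : ℝ => (s, (0 : ℝ)))
  have hGc (s : ℝ) : Continuous fun t => G (t, s) := hG.continuous.comp (by fun_prop)
  have hmp (s : ℝ) : m (s + 1) = m s := by
    simp only [hm, hR]
    exact intervalIntegral.integral_congr fun t _ => hp.2 (t, s)
  have hδ0 : 0 ≤ δ := (abs_nonneg _).trans (hδ 0)
  have hRb (x : ℝ × ℝ) : |R x| ≤ δ * |x.1| := by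
    have := intervalIntegral.norm_integral_le_of_norm_le_const (a := 0) (b := x.1)
      (f := fun t => G (t, x.2)) fun t _ => hδ (t, x.2)
    simpa using this
  have hmb (s : ℝ) : |m s| ≤ δ := by simpa using hRb (1, s)
  have hNb (s : ℝ) : |N s| ≤ δ * |s| := by
    have := intervalIntegral.norm_integral_le_of_norm_le_const (a := 0) (b := s)
      (f := m) fun t _ => hmb t
    simpa using this
  have hN1 : N 1 = 0 := by
    rw [← h0, integral_unitSquare_eq_iterated hG.continuous]
  have hNp (s : ℝ) : N (s + 1) = N s := by
    have h1 : N s + ∫ t in s..s + 1, m t = N (s + 1) :=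
      intervalIntegral.integral_add_adjacent_intervals (hms.continuous.intervalIntegrable _ _)
        (hms.continuous.intervalIntegrable _ _)
    have h2 : ∫ t in s..s + 1, m t = ∫ t in (0 : ℝ)..0 + 1, m t :=
      Function.Periodic.intervalIntegral_add_eq (f := m) (T := 1) hmp s 0
    have h3 : ∫ t in (0 : ℝ)..0 + 1, m t = 0 := by rw [zero_add]; exact hN1
    linarith
  have hRp (x : ℝ × ℝ) : R (x.1 + 1, x.2) = R x + m x.2 := by
    have h1 : R x + ∫ t in x.1..x.1 + 1, G (t, x.2) = R (x.1 + 1, x.2) :=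
      intervalIntegral.integral_add_adjacent_intervals ((hGc _).intervalIntegrable _ _)
        ((hGc _).intervalIntegrable _ _)
    have h2 : ∫ t in x.1..x.1 + 1, G (t, x.2) = ∫ t in (0 : ℝ)..0 + 1, G (t, x.2) :=
      Function.Periodic.intervalIntegral_add_eq (f := fun t => G (t, x.2)) (T := 1)
        (fun t => hp.1 (t, x.2)) x.1 0
    have h3 : ∫ t in (0 : ℝ)..0 + 1, G (t, x.2) = m x.2 := by rw [zero_add]
    linarith
  have hc2 : ContDiff ℝ (⊤ : ℕ∞) fun x : ℝ × ℝ => R x - x.1 * m x.2 :=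
    hRs.sub (contDiff_fst.mul (hms.comp contDiff_snd))
  have hc1 : ContDiff ℝ (⊤ : ℕ∞) fun x : ℝ × ℝ => -N x.2 := (hNs.comp contDiff_snd).neg
  refine ⟨fun x => -N x.2, fun x => R x - x.1 * m x.2, hc1, hc2,
    ⟨fun x => rfl, fun x => ?_⟩, ⟨fun x => ?_, fun x => ?_⟩, fun x => ?_, fun x hx => ?_⟩
  · simp only [hNp]
  · simp only [hRp]
    ring
  · have h1 : R (x.1, x.2 + 1) = R x := intervalIntegral.integral_congr fun t _ => hp.2 (t, x.2)
    simp only [hmp, h1]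
  · have h1 : pd1 (fun x : ℝ × ℝ => R x - x.1 * m x.2) x = G x - m x.2 := by
      refine pd1_eq_of_hasDerivAt (hc2.differentiable_top x) ?_
      have h2 : HasDerivAt (fun t => R (t, x.2)) (G (x.1, x.2)) x.1 :=
        (hGc x.2).integral_hasStrictDerivAt 0 x.1 |>.hasDerivAt
      simpa using h2.fun_sub ((hasDerivAt_id x.1).mul_const (m x.2))
    have h2 : pd2 (fun x : ℝ × ℝ => -N x.2) x = -m x.2 := by
      refine pd2_eq_of_hasDerivAt (hc1.differentiable_top x) ?_
      exact (hms.continuous.integral_hasStrictDerivAt 0 x.2).hasDerivAt.neg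
    rw [curv, h1, h2]
    ring
  · have hx1 : 0 ≤ x.1 ∧ x.1 ≤ 1 := ⟨hx.1.1, hx.2.1⟩
    have hx2 : 0 ≤ x.2 ∧ x.2 ≤ 1 := ⟨hx.1.2, hx.2.2⟩
    have b1 : |N x.2| ≤ δ := (hNb x.2).trans (by
      rw [abs_of_nonneg hx2.1]; exact mul_le_of_le_one_right hδ0 hx2.2)
    have b2 : |R x| ≤ δ := (hRb x).trans (by
      rw [abs_of_nonneg hx1.1]; exact mul_le_of_le_one_right hδ0 hx1.2)
    have b3 : |x.1 * m x.2| ≤ δ := by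
      rw [abs_mul, abs_of_nonneg hx1.1]
      exact (mul_le_of_le_one_left (abs_nonneg _) hx1.2).trans (hmb _)
    have b4 : |R x - x.1 * m x.2| ≤ 2 * δ := (abs_sub _ _).trans (by linarith)
    have s1 := sq_le_sq' (abs_le.1 b1).1 (abs_le.1 b1).2
    have s2 := sq_le_sq' (abs_le.1 b4).1 (abs_le.1 b4).2
    simp only [neg_sq]
    nlinarith
/-! ### Sections annihilated by the Dirac operator -/

lemma theta_sub_I (w : ℂ) : jacobiTheta₂ (w - I) I =
    Complex.exp (2 * Real.pi * I * w + Real.pi) * jacobiTheta₂ w I := by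
  have h := jacobiTheta₂_add_left' (w - I) I
  rw [sub_add_cancel] at h
  rw [h, ← mul_assoc, ← Complex.exp_add]
  have : 2 * Real.pi * I * w + Real.pi + -Real.pi * I * (I + 2 * (w - I)) = 0 := by
    ring_nf
    simp
  rw [this, Complex.exp_zero, one_mul]

lemma theta_zero_ne_zero : jacobiTheta₂ 0 I ≠ 0 := by
  intro h
  have h1 := norm_jacobiTheta_sub_one_le (τ := I) (by simp)
  rw [jacobiTheta_eq_jacobiTheta₂, h] at h1
  simp only [zero_sub, norm_neg, norm_one, I_im, mul_one] at h1
  have h2 : Real.exp (-Real.pi) < 1 / 4 := by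
    rw [Real.exp_neg, ← one_div]
    refine one_div_lt_one_div_of_lt (by norm_num) ?_
    have := Real.add_one_le_exp Real.pi
    linarith [Real.pi_gt_three]
  have h3 : 0 < 1 - Real.exp (-Real.pi) := by linarith
  rw [div_mul_eq_mul_div, le_div_iff₀ h3] at h1
  linarith

lemma exists_antiholomorphic_section (n : ℕ) : ∃ H : ℝ × ℝ → ℂ, ContDiff ℝ (⊤ : ℕ∞) H ∧
    (∀ x, pd1 H x - I * pd2 H x = 0) ∧ (∀ x : ℝ × ℝ, H (x.1 + 1, x.2) = H x) ∧
    (∀ x : ℝ × ℝ, H (x.1, x.2 + 1) =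
      Complex.exp (2 * Real.pi * I * n * x.1 + Real.pi * n * (2 * x.2 + 1)) * H x) ∧
    H (0, 0) ≠ 0 := by
  have hθ : Differentiable ℂ fun w => jacobiTheta₂ w I ^ n :=
    fun w => (differentiableAt_jacobiTheta₂_fst w (by simp)).pow n
  let T : ℝ × ℝ →L[ℝ] ℂ := ofRealCLM.comp (ContinuousLinearMap.fst ℝ ℝ ℝ) -
    I • ofRealCLM.comp (ContinuousLinearMap.snd ℝ ℝ ℝ)
  have hT (x : ℝ × ℝ) : T x = x.1 - I * x.2 := by simp [T]
  refine ⟨fun x => jacobiTheta₂ (T x) I ^ n, ?_, fun x => ?_, fun x => ?_, fun x => ?_, ?_⟩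
  · exact ((hθ.contDiff (n := (⊤ : ℕ∞))).restrict_scalars ℝ).comp T.contDiff
  · have h : HasFDerivAt (fun x => jacobiTheta₂ (T x) I ^ n) _ x :=
      (hθ (T x)).hasDerivAt.hasFDerivAt.restrictScalars ℝ |>.comp x T.hasFDerivAt
    rw [pd1_eq_of_hasFDerivAt h, pd2_eq_of_hasFDerivAt h]
    simp only [ContinuousLinearMap.comp_apply, hT]
    simp
    ring_nf
    simp
  · have h : T (x.1 + 1, x.2) = T x + 1 := by simp only [hT]; push_cast; ring
    simp only [h, jacobiTheta₂_add_left]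
  · have h : T (x.1, x.2 + 1) = T x - I := by simp only [hT]; push_cast; ring
    simp only [h, theta_sub_I, mul_pow, ← Complex.exp_nat_mul]
    congr 2
    rw [hT]
    ring_nf
    simp
  · simp only [hT]
    simpa using pow_ne_zero n theta_zero_ne_zero

lemma D1_sub_D2_exp_mul {v c1 c2 : ℝ × ℝ → ℝ} {H : ℝ × ℝ → ℂ} (hv : ContDiff ℝ (⊤ : ℕ∞) v)
    (hH : ContDiff ℝ (⊤ : ℕ∞) H) (x : ℝ × ℝ) (h : pd1 H x - I * pd2 H x = 0) :
    D1 (fun y => pd2 v y + c1 y) (fun y => Complex.exp (v y) * H y) x -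
      I * D2 (fun y => -pd1 v y + c2 y) (fun y => Complex.exp (v y) * H y) x =
      (I * c1 x + c2 x) * (Complex.exp (v x) * H x) := by
  have h1 := (ofRealCLM.hasFDerivAt.comp x (hv.differentiable_top x).hasFDerivAt).cexp
  have hd : DifferentiableAt ℝ (fun y => Complex.exp (v y)) x := h1.differentiableAt
  have e1 : pd1 (fun y => Complex.exp (v y)) x = Complex.exp (v x) * pd1 v x := by
    simpa [pd1] using pd1_eq_of_hasFDerivAt h1
  have e2 : pd2 (fun y => Complex.exp (v y)) x = Complex.exp (v x) * pd2 v x := by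
    simpa [pd2] using pd2_eq_of_hasFDerivAt h1
  have hHx := hH.differentiable_top x
  simp only [D1, D2, pd1_mul hd hHx, pd2_mul hd hHx, e1, e2]
  push_cast
  linear_combination Complex.exp (v x) * h +
    (Complex.exp (v x) * H x) * (((pd1 v x : ℝ) : ℂ) - c2 x) * I_sq

/-- For non-negative degree there are connections with the prescribed curvature and normalised
sections of Dirichlet energy arbitrarily close to `∫ F₀ |φ|²`. -/
lemma exists_fieldPair_of_nat (n : ℕ) {F₀ : ℝ × ℝ → ℝ} (hF₀ : ExternalField n F₀) {M ε : ℝ}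
    (hM : ∀ x ∈ unitSquare, F₀ x ≤ M) (hε : 0 < ε) :
    ∃ P : FieldPair n, (∀ x, curv P.a1 P.a2 x = F₀ x) ∧
      (∫ x in unitSquare, ‖P.φ x‖ ^ 2) = 1 ∧ P.dirichlet ≤ 5 * ε ^ 2 + M := by
  obtain ⟨hFs, hF1, hF2, hFi⟩ := hF₀
  obtain ⟨u, hu, hup, c, huc⟩ := exists_laplacian_approx (f := fun x => -F₀ x)
    hFs.continuous.neg ⟨fun x => congrArg _ (hF1 x), fun x => congrArg _ (hF2 x)⟩ (half_pos hε)
  have hls := contDiff_laplacian hu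
  have hlp := hup.laplacian
  have hint (e : ℝ) : ∫ x in unitSquare, (F₀ x + laplacian u x + e) = 2 * Real.pi * n + e := by
    have h1 := hFs.continuous.integrableOn_unitSquare
    have h2 := hls.continuous.integrableOn_unitSquare
    have h3 : IntegrableOn (fun _ : ℝ × ℝ => e) unitSquare :=
      continuous_const.integrableOn_unitSquare
    have h4 : IntegrableOn (fun x => F₀ x + laplacian u x) unitSquare := h1.add h2
    rw [integral_add h4 h3, integral_add h1 h2, integral_laplacian hu hup, hFi,
      setIntegral_unitSquare_const]
    push_cast
    ring
  have hb (x : ℝ × ℝ) : |F₀ x + laplacian u x + c| ≤ ε / 2 := by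
    rw [← abs_neg]
    convert huc x using 2
    ring
  have hcb : |2 * Real.pi * n + c| ≤ ε / 2 := by
    rw [← hint c, ← setIntegral_unitSquare_const (ε / 2)]
    refine abs_integral_le_integral_abs.trans (integral_mono ?_ ?_ hb)
    · exact ((hFs.add hls).add contDiff_const).continuous.abs.integrableOn_unitSquare
    · exact continuous_const.integrableOn_unitSquare
  obtain ⟨c1, c2, hc1, hc2, hp1, hp2, hcurv, hbd⟩ := exists_potential
    (G := fun x => F₀ x + laplacian u x + -(2 * Real.pi * n)) (δ := ε)
    ((hFs.add hls).add contDiff_const)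
    ⟨fun x => by simp only [hF1, hlp.1], fun x => by simp only [hF2, hlp.2]⟩
    (by rw [hint]; ring) (fun x => by
      have : F₀ x + laplacian u x + -(2 * Real.pi * n) =
        (F₀ x + laplacian u x + c) - (2 * Real.pi * n + c) := by ring
      rw [this]
      exact (abs_sub _ _).trans (by linarith [hb x]))
  obtain ⟨H, hH, hH0, hHp1, hHp2, hHne⟩ := exists_antiholomorphic_section n
  set v : ℝ × ℝ → ℝ := fun x => u x + -(Real.pi * n * x.2 ^ 2) with hv
  have hq : ContDiff ℝ (⊤ : ℕ∞) fun x : ℝ × ℝ => -(Real.pi * n * x.2 ^ 2) := by fun_prop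
  have hvs : ContDiff ℝ (⊤ : ℕ∞) v := hu.add hq
  have hv1 (x : ℝ × ℝ) : pd1 v x = pd1 u x := by
    have : pd1 (fun x : ℝ × ℝ => -(Real.pi * n * x.2 ^ 2)) x = 0 :=
      pd1_eq_of_hasDerivAt (hq.differentiable_top x)
        (hasDerivAt_const x.1 (-(Real.pi * n * x.2 ^ 2)))
    rw [hv, pd1_add (hu.differentiable_top x) (hq.differentiable_top x), this, add_zero]
  have hv2 (x : ℝ × ℝ) : pd2 v x = pd2 u x - 2 * Real.pi * n * x.2 := by
    have : pd2 (fun x : ℝ × ℝ => -(Real.pi * n * x.2 ^ 2)) x = -(Real.pi * n * (2 * x.2)) :=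
      pd2_eq_of_hasDerivAt (hq.differentiable_top x)
        (by simpa using ((hasDerivAt_pow 2 x.2).const_mul (Real.pi * n)).fun_neg)
    rw [hv, pd2_add (hu.differentiable_top x) (hq.differentiable_top x), this]
    ring
  have hlv (x : ℝ × ℝ) : laplacian v x = laplacian u x - 2 * Real.pi * n := by
    have h1 : pd1 v = pd1 u := funext hv1
    have h2 : pd2 v = fun x => pd2 u x + -(2 * Real.pi * n * x.2) :=
      funext fun x => by rw [hv2]; ring
    have h3 : Differentiable ℝ fun x : ℝ × ℝ => -(2 * Real.pi * n * x.2) := by fun_prop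
    have h4 : pd2 (fun x : ℝ × ℝ => -(2 * Real.pi * n * x.2)) x = -(2 * Real.pi * n) :=
      pd2_eq_of_hasDerivAt (h3 x)
        (by simpa using ((hasDerivAt_id x.2).const_mul (2 * Real.pi * n)).fun_neg)
    rw [laplacian, h1, h2, pd2_add ((contDiff_pd2 hu).differentiable_top x) (h3 x), h4, laplacian]
    ring
  have hψs : ContDiff ℝ (⊤ : ℕ∞) fun x => Complex.exp (v x) * H x :=
    (ofRealCLM.contDiff.comp hvs).cexp.mul hH
  set Z : ℝ := ∫ x in unitSquare, ‖Complex.exp (v x) * H x‖ ^ 2 with hZ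
  have hZpos : 0 < Z := by
    refine integral_unitSquare_pos (hψs.continuous.norm.pow 2) (fun x => sq_nonneg _) ?_
    exact pow_pos (norm_pos_iff.2 (mul_ne_zero (Complex.exp_ne_zero _) hHne)) 2
  have hZs : (Real.sqrt Z)⁻¹ ^ 2 = Z⁻¹ := by rw [inv_pow, Real.sq_sqrt hZpos.le]
  set K : ℝ × ℝ → ℂ := fun x => ((Real.sqrt Z)⁻¹ : ℝ) * H x with hK
  have hKs : ContDiff ℝ (⊤ : ℕ∞) K := contDiff_const.mul hH
  have hK0 (x : ℝ × ℝ) : pd1 K x - I * pd2 K x = 0 := by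
    have e1 : pd1 K x = ((Real.sqrt Z)⁻¹ : ℝ) * pd1 H x :=
      pd1_clm (ContinuousLinearMap.mul ℝ ℂ ((Real.sqrt Z)⁻¹ : ℝ)) (hH.differentiable_top x)
    have e2 : pd2 K x = ((Real.sqrt Z)⁻¹ : ℝ) * pd2 H x :=
      pd2_clm (ContinuousLinearMap.mul ℝ ℂ ((Real.sqrt Z)⁻¹ : ℝ)) (hH.differentiable_top x)
    rw [e1, e2]
    linear_combination ((Real.sqrt Z)⁻¹ : ℝ) * hH0 x
  let P : FieldPair n :=
    { a1 := fun x => pd2 v x + c1 x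
      a2 := fun x => -pd1 v x + c2 x
      φ := fun x => Complex.exp (v x) * K x
      smooth_a1 := (contDiff_pd2 hvs).add hc1
      smooth_a2 := (contDiff_pd1 hvs).neg.add hc2
      smooth_φ := (ofRealCLM.contDiff.comp hvs).cexp.mul hKs
      per1_a1 := fun x => by simp only [hv2, hup.pd2.1, hp1.1]
      per1_a2 := fun x => by simp only [hv1, hup.pd1.1, hp2.1]
      per1_φ := fun x => by simp only [hv, hK, hup.1, hHp1]
      per2_a2 := fun x => by simp only [hv1, hup.pd1.2, hp2.2]
      per2_a1 := fun x => by
        simp only [hv2, hup.pd2.2, hp1.2]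
        push_cast
        ring
      per2_φ := fun x => by
        simp only [hv, hK, hup.2, hHp2]
        rw [mul_left_comm _ (Complex.exp _) (H x), ← mul_assoc, ← mul_assoc (Complex.exp _),
          ← Complex.exp_add, ← Complex.exp_add]
        congr 2
        push_cast
        ring }
  have hPcurv (x : ℝ × ℝ) : curv P.a1 P.a2 x = F₀ x := by
    have e1 : pd1 P.a2 x = -pd1 (pd1 v) x + pd1 c2 x := by
      rw [← pd1_neg]
      exact pd1_add ((contDiff_pd1 hvs).neg.differentiable_top x) (hc2.differentiable_top x)
    have e2 : pd2 P.a1 x = pd2 (pd2 v) x + pd2 c1 x :=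
      pd2_add ((contDiff_pd2 hvs).differentiable_top x) (hc1.differentiable_top x)
    have e3 := hcurv x
    have e4 := hlv x
    rw [laplacian] at e4
    simp only [curv] at e3 ⊢
    rw [e1, e2]
    linarith
  have hPnorm : ∫ x in unitSquare, ‖P.φ x‖ ^ 2 = 1 := by
    have (x : ℝ × ℝ) : ‖P.φ x‖ ^ 2 = Z⁻¹ * ‖Complex.exp (v x) * H x‖ ^ 2 := by
      simp only [P, hK]
      rw [mul_left_comm, norm_mul, mul_pow, norm_real, Real.norm_eq_abs, sq_abs, hZs]
    simp_rw [this]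
    rw [integral_const_mul, ← hZ, inv_mul_cancel₀ hZpos.ne']
  refine ⟨P, hPcurv, hPnorm, ?_⟩
  have hcφ : Continuous fun x => ‖P.φ x‖ ^ 2 := P.smooth_φ.continuous.norm.pow 2
  have hmono {A : ℝ} {f : ℝ × ℝ → ℝ} (hf : Continuous f)
      (h : ∀ x ∈ unitSquare, f x ≤ A * ‖P.φ x‖ ^ 2) :
      ∫ x in unitSquare, f x ≤ A := by
    calc _ ≤ ∫ x in unitSquare, A * ‖P.φ x‖ ^ 2 :=
          setIntegral_mono_on hf.integrableOn_unitSquare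
            (continuous_const.mul hcφ).integrableOn_unitSquare measurableSet_Icc h
      _ = A := by rw [integral_const_mul, hPnorm, mul_one]
  rw [P.dirichlet_eq]
  refine add_le_add (hmono ((P.continuous_D1.sub
      (continuous_const.mul P.continuous_D2)).norm.pow 2) fun x hx => ?_) (hmono ?_ fun x hx => ?_)
  · rw [D1_sub_D2_exp_mul (c1 := c1) (c2 := c2) hvs hKs x (hK0 x), norm_mul, mul_pow]
    refine mul_le_mul_of_nonneg_right ?_ (sq_nonneg _)
    refine le_trans (le_of_eq ?_) (hbd x hx)
    rw [← normSq_eq_norm_sq, normSq_apply]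
    simp
    ring
  · simp_rw [hPcurv]
    exact hFs.continuous.mul hcφ
  · rw [hPcurv]
    exact mul_le_mul_of_nonneg_right (hM x hx) (sq_nonneg _)
/-! ### Conjugation and the eigenvalue bounds -/

lemma D1_conj {a : ℝ × ℝ → ℝ} {φ : ℝ × ℝ → ℂ} (hφ : ContDiff ℝ (⊤ : ℕ∞) φ) (x : ℝ × ℝ) :
    D1 (fun y => -a y) (fun y => (starRingEnd ℂ) (φ y)) x = (starRingEnd ℂ) (D1 a φ x) := by
  have h : pd1 (fun y => (starRingEnd ℂ) (φ y)) x = (starRingEnd ℂ) (pd1 φ x) :=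
    pd1_clm conjCLE.toContinuousLinearMap (hφ.differentiable_top x)
  simp [D1, h]

lemma D2_conj {a : ℝ × ℝ → ℝ} {φ : ℝ × ℝ → ℂ} (hφ : ContDiff ℝ (⊤ : ℕ∞) φ) (x : ℝ × ℝ) :
    D2 (fun y => -a y) (fun y => (starRingEnd ℂ) (φ y)) x = (starRingEnd ℂ) (D2 a φ x) := by
  have h : pd2 (fun y => (starRingEnd ℂ) (φ y)) x = (starRingEnd ℂ) (pd2 φ x) :=
    pd2_clm conjCLE.toContinuousLinearMap (hφ.differentiable_top x)
  simp [D2, h]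

namespace FieldPair

/-- The complex conjugate field pair, living on the dual line bundle. -/
def conj {d e : ℤ} (h : e = -d) (P : FieldPair d) : FieldPair e where
  a1 := fun x => -P.a1 x
  a2 := fun x => -P.a2 x
  φ := fun x => (starRingEnd ℂ) (P.φ x)
  smooth_a1 := P.smooth_a1.neg
  smooth_a2 := P.smooth_a2.neg
  smooth_φ := conjCLE.contDiff.comp P.smooth_φ
  per1_a1 := fun x => by rw [P.per1_a1]
  per1_a2 := fun x => by rw [P.per1_a2]
  per1_φ := fun x => by rw [P.per1_φ]
  per2_a2 := fun x => by rw [P.per2_a2]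
  per2_a1 := fun x => by
    rw [P.per2_a1, h]
    push_cast
    ring
  per2_φ := fun x => by
    have h2 : (starRingEnd ℂ) 2 = 2 := Complex.conj_ofNat 2
    rw [P.per2_φ, map_mul, ← Complex.exp_conj, h]
    simp [h2]

variable {d e : ℤ} (h : e = -d) (P : FieldPair d)

lemma curv_conj (x : ℝ × ℝ) : curv (P.conj h).a1 (P.conj h).a2 x = -curv P.a1 P.a2 x := by
  simp only [curv, conj, pd1_neg, pd2_neg]
  ring

lemma norm_conj_φ (x : ℝ × ℝ) : ‖(P.conj h).φ x‖ = ‖P.φ x‖ := norm_conj _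

lemma dirichlet_conj : (P.conj h).dirichlet = P.dirichlet := by
  simp only [dirichlet, conj, D1_conj P.smooth_φ, D2_conj P.smooth_φ, norm_conj]

/-- The infimum of `|curv|` bounds the Dirichlet energy of a normalised section from below. -/
lemma le_dirichlet (hφ : ∫ x in unitSquare, ‖P.φ x‖ ^ 2 = 1) {m : ℝ}
    (hm : ∀ x ∈ unitSquare, m ≤ |curv P.a1 P.a2 x|) : m ≤ P.dirichlet := by
  have hc : Continuous (curv P.a1 P.a2) :=
    (contDiff_pd1 P.smooth_a2).continuous.sub (contDiff_pd2 P.smooth_a1).continuous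
  have hcφ : Continuous fun x => ‖P.φ x‖ ^ 2 := P.smooth_φ.continuous.norm.pow 2
  have hle : m ≤ ∫ x in unitSquare, |curv P.a1 P.a2 x| * ‖P.φ x‖ ^ 2 := by
    calc m = ∫ x in unitSquare, m * ‖P.φ x‖ ^ 2 := by rw [integral_const_mul, hφ, mul_one]
      _ ≤ _ := setIntegral_mono_on (continuous_const.mul hcφ).integrableOn_unitSquare
          (hc.abs.mul hcφ).integrableOn_unitSquare measurableSet_Icc
          fun x hx => mul_le_mul_of_nonneg_right (hm x hx) (sq_nonneg _)
  by_cases hpos : ∀ x ∈ unitSquare, 0 ≤ curv P.a1 P.a2 x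
  · have hi : ∫ x in unitSquare, |curv P.a1 P.a2 x| * ‖P.φ x‖ ^ 2 =
        ∫ x in unitSquare, curv P.a1 P.a2 x * ‖P.φ x‖ ^ 2 :=
      setIntegral_congr_fun measurableSet_Icc fun x hx => by
        simp only [abs_of_nonneg (hpos x hx)]
    rw [hi] at hle
    exact hle.trans ((le_abs_self _).trans P.abs_integral_curv_le)
  by_cases hneg : ∀ x ∈ unitSquare, curv P.a1 P.a2 x ≤ 0
  · have hi : ∫ x in unitSquare, |curv P.a1 P.a2 x| * ‖P.φ x‖ ^ 2 =
        ∫ x in unitSquare, -(curv P.a1 P.a2 x * ‖P.φ x‖ ^ 2) :=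
      setIntegral_congr_fun measurableSet_Icc fun x hx => by
        simp only [abs_of_nonpos (hneg x hx), neg_mul]
    rw [hi, integral_neg] at hle
    exact hle.trans ((neg_le_abs _).trans P.abs_integral_curv_le)
  push Not at hpos hneg
  obtain ⟨y, hy, hy0⟩ := hpos
  obtain ⟨z, hz, hz0⟩ := hneg
  obtain ⟨w, hw, hw0⟩ := (convex_Icc ((0 : ℝ), (0 : ℝ)) (1, 1)).isPreconnected.intermediate_value
    hy hz hc.continuousOn ⟨hy0.le, hz0.le⟩
  have := hm w hw
  rw [hw0, abs_zero] at this
  exact this.trans P.dirichlet_nonneg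

end FieldPair

lemma exists_fieldPair {d : ℤ} {F₀ : ℝ × ℝ → ℝ} (hF₀ : ExternalField d F₀) {M ε : ℝ}
    (hM : ∀ x ∈ unitSquare, |F₀ x| ≤ M) (hε : 0 < ε) :
    ∃ P : FieldPair d, (∀ x, curv P.a1 P.a2 x = F₀ x) ∧
      (∫ x in unitSquare, ‖P.φ x‖ ^ 2) = 1 ∧ P.dirichlet ≤ M + ε := by
  have hs : 5 * Real.sqrt (ε / 5) ^ 2 = ε := by
    rw [Real.sq_sqrt (by positivity)]
    ring
  have hpos : 0 < Real.sqrt (ε / 5) := Real.sqrt_pos.2 (by positivity)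
  obtain ⟨n, rfl | rfl⟩ := d.eq_nat_or_neg
  · obtain ⟨P, h1, h2, h3⟩ := exists_fieldPair_of_nat n hF₀
      (fun x hx => (le_abs_self _).trans (hM x hx)) hpos
    exact ⟨P, h1, h2, by linarith⟩
  · have hF : ExternalField n fun x => -F₀ x := by
      obtain ⟨h1, h2, h3, h4⟩ := hF₀
      refine ⟨h1.neg, fun x => congrArg _ (h2 x), fun x => congrArg _ (h3 x), ?_⟩
      rw [integral_neg, h4]
      push_cast
      ring
    obtain ⟨P, h1, h2, h3⟩ := exists_fieldPair_of_nat n hF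
      (fun x hx => (neg_le_abs _).trans (hM x hx)) hpos
    refine ⟨P.conj rfl, fun x => ?_, ?_, ?_⟩
    · rw [P.curv_conj, h1, neg_neg]
    · simp_rw [P.norm_conj_φ, h2]
    · rw [P.dirichlet_conj]
      linarith

/-- `inf_{[0,1]²} |F₀| ≤ λ₁ ≤ sup_{[0,1]²} |F₀|`. -/
theorem statement11 (d : ℤ) (F₀ : ℝ × ℝ → ℝ) (hF₀ : ExternalField d F₀) :
    sInf ((fun x : ℝ × ℝ => |F₀ x|) '' unitSquare) ≤ lambda1 d F₀ ∧
    lambda1 d F₀ ≤ sSup ((fun x : ℝ × ℝ => |F₀ x|) '' unitSquare) := by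
  have hbelow : BddBelow ((fun x : ℝ × ℝ => |F₀ x|) '' unitSquare) :=
    ⟨0, by rintro _ ⟨x, _, rfl⟩; exact abs_nonneg _⟩
  have habove : BddAbove ((fun x : ℝ × ℝ => |F₀ x|) '' unitSquare) :=
    (isCompact_unitSquare.image hF₀.1.continuous.abs).bddAbove
  have hM (x : ℝ × ℝ) (hx : x ∈ unitSquare) :
      |F₀ x| ≤ sSup ((fun x : ℝ × ℝ => |F₀ x|) '' unitSquare) :=
    le_csSup habove (Set.mem_image_of_mem _ hx)
  constructor
  · obtain ⟨P, h1, h2, -⟩ := exists_fieldPair hF₀ hM one_pos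
    refine le_csInf ⟨P.dirichlet, P, h1, h2, rfl⟩ ?_
    rintro _ ⟨Q, h1, h2, rfl⟩
    refine Q.le_dirichlet h2 fun x hx => ?_
    rw [h1]
    exact csInf_le hbelow (Set.mem_image_of_mem _ hx)
  · refine le_of_forall_pos_le_add fun ε hε => ?_
    obtain ⟨P, h1, h2, h3⟩ := exists_fieldPair hF₀ hM hε
    have hle : lambda1 d F₀ ≤ P.dirichlet := by
      refine csInf_le ⟨0, ?_⟩ ⟨P, h1, h2, rfl⟩
      rintro _ ⟨Q, -, -, rfl⟩
      exact Q.dirichlet_nonneg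
    exact hle.trans h3
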